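/- Let G be a finite Frobenius group whose kernel F is an abelian p-group and with complement of order n. Then van(G) = G − F and pv(G) = 1 − 1/n. -/

import Mathlib

open CategoryTheory

/-- An element `g` of a group is a *vanishing element* if some irreducible complex
character vanishes at `g`. -/
def IsVanishing {G : Type} [Group G] (g : G) : Prop :=
  ∃ V : FDRep ℂ G, Simple V ∧ V.character g = 0

/-- The proportion of vanishing elements of `G`. -/
noncomputable def pv (G : Type) [Group G] : ℝ :=
  (Set.ncard {g : G | IsVanishing g}) / (Nat.card G)

/-- The proportion of non-vanishing elements of `G`. -/
noncomputable def pnv (G : Type) [Group G] : ℝ :=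
  (Set.ncard {g : G | ¬ IsVanishing g}) / (Nat.card G)


/-- `G` is a Frobenius group with kernel `F`: `F` is a nontrivial proper normal subgroup
and the centralizer of every nonidentity element of `F` is contained in `F`. -/
def IsFrobeniusWithKernel (G : Type) [Group G] (F : Subgroup G) : Prop :=
  F.Normal ∧ F ≠ ⊥ ∧ F ≠ ⊤ ∧
    ∀ x ∈ F, x ≠ 1 → ∀ g : G, g * x = x * g → g ∈ F

section

open Module Polynomial

namespace Representation

variable {k G V : Type*} [Field k] [AddCommGroup V] [Module k V]

section Monoid

variable [Monoid G]

/-- A nonzero finite-dimensional representation has an irreducible subrepresentation. -/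
theorem exists_isIrreducible_subrepresentation [FiniteDimensional k V] [Nontrivial V]
    (ρ : Representation k G V) :
    ∃ W : Subrepresentation ρ, IsIrreducible W.toRepresentation := by
  have hmono : StrictMono (Subrepresentation.toSubmodule (ρ := ρ)) := fun _ _ h => h
  have : WellFoundedLT (Subrepresentation ρ) := hmono.wellFoundedLT
  have : Nontrivial (Subrepresentation ρ) :=
    ⟨⊥, ⊤, fun h => bot_ne_top (congrArg Subrepresentation.toSubmodule h)⟩
  have : IsAtomic (Subrepresentation ρ) := isAtomic_of_orderBot_wellFounded_lt wellFounded_lt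
  obtain ⟨W, hW⟩ := IsAtomic.exists_atom (Subrepresentation ρ)
  refine ⟨W, ?_⟩
  have hbot : W.toSubmodule ≠ ⊥ := fun h => hW.1 (Subrepresentation.toSubmodule_injective h)
  have : Nontrivial (Subrepresentation W.toRepresentation) := by
    have := Submodule.nontrivial_iff_ne_bot.2 hbot
    exact ⟨⊥, ⊤, fun h => bot_ne_top (α := Submodule k W.toSubmodule)
      (congrArg Subrepresentation.toSubmodule h)⟩
  refine ⟨fun U => ?_⟩
  let U' : Subrepresentation ρ :=
    ⟨U.toSubmodule.map W.toSubmodule.subtype, by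
      rintro g _ ⟨u, hu, rfl⟩
      exact ⟨W.toRepresentation g u, U.apply_mem_toSubmodule g hu, rfl⟩⟩
  have hU' : U' ≤ W := Submodule.map_subtype_le W.toSubmodule U.toSubmodule
  rcases hW.le_iff.1 hU' with h | h
  · left
    apply Subrepresentation.toSubmodule_injective
    have h2 : U.toSubmodule.map W.toSubmodule.subtype = ⊥ :=
      congrArg Subrepresentation.toSubmodule h
    exact Submodule.map_injective_of_injective W.toSubmodule.injective_subtype
      (h2.trans (Submodule.map_bot _).symm)
  · right
    apply Subrepresentation.toSubmodule_injective
    have h2 : U.toSubmodule.map W.toSubmodule.subtype = W.toSubmodule :=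
      congrArg Subrepresentation.toSubmodule h
    apply Submodule.map_injective_of_injective W.toSubmodule.injective_subtype
    rw [h2]
    exact (Submodule.map_subtype_top _).symm

/-- A commutative monoid acting on a nonzero finite-dimensional space over an algebraically closed
field has a common eigenvector. -/
theorem exists_forall_apply_eq_smul [IsMulCommutative G] [IsAlgClosed k] [FiniteDimensional k V]
    [Nontrivial V] (ρ : Representation k G V) :
    ∃ v ≠ 0, ∃ l : G → k, ∀ g, ρ g v = l g • v := by
  obtain ⟨W, hW⟩ := ρ.exists_isIrreducible_subrepresentation
  have h1 := IsIrreducible.finrank_eq_one_of_isMulCommutative W.toRepresentation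
  obtain ⟨w, hw, hspan⟩ := finrank_eq_one_iff'.1 h1
  choose l hl using fun g => hspan (W.toRepresentation g w)
  refine ⟨w, by simpa using hw, l, fun g => ?_⟩
  exact (congrArg Subtype.val (hl g)).symm

end Monoid

section FrobeniusKernel

variable [Group G] {F : Subgroup G}

/-- If conjugation by elements of `F` acts without fixed points outside `F`, then for `g ∉ F` the
commutator map `x ↦ x * g * x⁻¹ * g⁻¹` permutes `F`. -/
theorem _root_.Subgroup.bijective_commutator_of_centralizer_le [Finite G] [hN : F.Normal]
    (hC : ∀ x ∈ F, x ≠ 1 → ∀ g : G, g * x = x * g → g ∈ F) {g : G} (hg : g ∉ F) :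
    Function.Bijective fun x : F =>
      (⟨x * g * (x : G)⁻¹ * g⁻¹, by
        simpa [mul_assoc] using F.mul_mem x.2 (hN.conj_mem _ (F.inv_mem x.2) g)⟩ : F) := by
  rw [← Finite.injective_iff_bijective]
  intro x y h
  have h1 : (x : G) * g * (x : G)⁻¹ = y * g * (y : G)⁻¹ :=
    mul_right_cancel (congrArg Subtype.val h)
  by_contra hxy
  refine hg (hC ((y : G)⁻¹ * x) (F.mul_mem (F.inv_mem y.2) x.2) ?_ g ?_)
  · intro h2
    exact hxy (Subtype.ext (inv_mul_eq_one.1 h2).symm)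
  · have h3 : (x : G) * g = y * g * (y : G)⁻¹ * x := by rw [← h1]; group
    rw [mul_assoc, h3]
    group

theorem character_eq_zero_of_sum_eq_zero [Finite G] [F.Normal] [Fintype F] [CharZero k]
    (ρ : Representation k G V)
    (hC : ∀ x ∈ F, x ≠ 1 → ∀ g : G, g * x = x * g → g ∈ F)
    (hsum : ∑ x : F, ρ x = 0) {g : G} (hg : g ∉ F) : ρ.character g = 0 := by
  have hb := Subgroup.bijective_commutator_of_centralizer_le hC hg
  have h1 : ∑ x : F, ρ.character (x * g) = 0 := by
    have := congrArg (fun f => LinearMap.trace k V (f * ρ g)) hsum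
    simpa [Finset.sum_mul, character] using this
  rw [← hb.sum_comp (fun x : F => ρ.character (x * g))] at h1
  simpa using h1

theorem sum_eq_zero_or_forall_eq_one [F.Normal] [Fintype F]
    (ρ : Representation k G V) [IsIrreducible ρ] :
    ∑ x : F, ρ x = 0 ∨ ∀ x ∈ F, ρ x = 1 := by
  let W : Subrepresentation ρ :=
    ⟨⨅ x : F, LinearMap.eqLocus (ρ x) 1, by
      intro g v hv
      simp only [Submodule.mem_iInf, LinearMap.mem_eqLocus, Module.End.one_apply] at hv ⊢
      intro x
      have h := hv ⟨g⁻¹ * x * g, by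
        simpa using (inferInstance : F.Normal).conj_mem _ x.2 g⁻¹⟩
      rw [← Module.End.mul_apply, ← map_mul]
      conv_rhs => rw [← h]
      rw [← Module.End.mul_apply, ← map_mul]
      congr 2
      group⟩
  have hmem (v : V) : v ∈ W.toSubmodule ↔ ∀ x : F, ρ x v = v := by simp [W]
  rcases eq_bot_or_eq_top W with h | h
  · left
    ext v
    have : (∑ x : F, ρ x) v ∈ W.toSubmodule := by
      rw [hmem]
      intro y
      simp only [LinearMap.sum_apply, map_sum, ← Module.End.mul_apply, ← map_mul]
      exact Fintype.sum_equiv (Equiv.mulLeft y) _ (fun x : F => ρ x v) fun _ => rfl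
    rw [h] at this
    simpa using (Submodule.mem_bot k).1 this
  · right
    intro x hx
    ext v
    exact (hmem v).1 (h ▸ Submodule.mem_top) ⟨x, hx⟩

theorem finrank_eq_index_of_sum_eq_zero [Finite G] [F.Normal] [Fintype F] [CharZero k]
    [IsAlgClosed k] [IsMulCommutative F] [FiniteDimensional k V]
    (ρ : Representation k G V) [IsIrreducible ρ]
    (hC : ∀ x ∈ F, x ≠ 1 → ∀ g : G, g * x = x * g → g ∈ F)
    (hsum : ∑ x : F, ρ x = 0) : finrank k V = F.index := by
  have : Nontrivial V := by
    by_contra h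
    rw [not_nontrivial_iff_subsingleton] at h
    exact bot_ne_top (α := Subrepresentation ρ)
      (Subrepresentation.toSubmodule_injective (Subsingleton.elim _ _))
  obtain ⟨v, hv, l, hl⟩ := exists_forall_apply_eq_smul (ρ.comp F.subtype : Representation k F V)
  replace hl (x : F) : ρ x v = l x • v := hl x
  have hinv (g : G) : ρ g⁻¹ (ρ g v) = v := by simp
  have hl_mul (x y : F) : l (x * y) = l x * l y := by
    apply smul_left_injective k hv
    simp only
    rw [← hl, Subgroup.coe_mul, map_mul, Module.End.mul_apply, hl, map_smul, hl, smul_smul, mul_comm]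
  have hl_ne (x : F) : l x ≠ 0 := by
    intro h
    have := hinv x
    rw [hl, h] at this
    simp [hv.symm] at this
  let c (g : G) (x : F) : F := ⟨g⁻¹ * x * g, by
    simpa using (inferInstance : F.Normal).conj_mem _ x.2 g⁻¹⟩
  have hc (g : G) (x : F) : ρ x (ρ g v) = l (c g x) • ρ g v := by
    rw [← map_smul, ← hl, ← Module.End.mul_apply, ← Module.End.mul_apply, ← map_mul, ← map_mul]
    congr 2
    simp [c, mul_assoc]
  have hstab (g : G) (h : ∀ x, l (c g x) = l x) : g ∈ F := by
    by_contra hg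
    have hone (y : F) : l y = 1 := by
      have hg' : g⁻¹ ∉ F := fun h => hg (by simpa using h)
      obtain ⟨x, hx⟩ := (Subgroup.bijective_commutator_of_centralizer_le hC hg').2 y
      have hy : y = x * (c g x)⁻¹ := by
        rw [← hx]
        ext
        simp [c, mul_assoc]
      have h1 : l y * l (c g x) = l x := by rw [← hl_mul, hy]; simp
      rw [h] at h1
      exact (mul_eq_right₀ (hl_ne x)).1 h1
    have := congrArg (fun f => f v) hsum
    simp [LinearMap.sum_apply, hl, hone, ← Nat.cast_smul_eq_nsmul k, hv] at this
  let w (q : G ⧸ F) : V := ρ q.out v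
  have hw (g : G) : ∃ a : k, ρ g v = a • w g := by
    obtain ⟨x, hx⟩ := QuotientGroup.mk_out_eq_mul F g
    refine ⟨l x⁻¹, ?_⟩
    simp only [w]
    rw [hx, map_mul, Module.End.mul_apply, hl, map_smul, smul_smul, ← hl_mul]
    have : l 1 = 1 := (mul_eq_right₀ (hl_ne 1)).1 (by rw [← hl_mul, one_mul])
    simp [this]
  let U : Subrepresentation ρ :=
    ⟨Submodule.span k (Set.range w), by
      intro g u hu
      induction hu using Submodule.span_induction with
      | mem u hu =>
        obtain ⟨q, rfl⟩ := hu
        obtain ⟨a, ha⟩ := hw (g * q.out)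
        simp only [w]
        rw [← Module.End.mul_apply, ← map_mul, ha]
        exact Submodule.smul_mem _ _ (Submodule.subset_span ⟨_, rfl⟩)
      | zero => simp
      | add u u' _ _ h h' => rw [map_add]; exact Submodule.add_mem _ h h'
      | smul a u _ h => rw [map_smul]; exact Submodule.smul_mem _ _ h⟩
  have hw0 (q : G ⧸ F) : w q ≠ 0 := by
    intro h
    have := hinv q.out
    simp only [w] at h
    rw [h, map_zero] at this
    exact hv this.symm
  have hspan : Submodule.span k (Set.range w) = ⊤ := by
    rcases eq_bot_or_eq_top U with h | h
    · have h1 : w (1 : G) ∈ U.toSubmodule := Submodule.subset_span ⟨_, rfl⟩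
      rw [h] at h1
      exact (hw0 _ ((Submodule.mem_bot k).1 h1)).elim
    · exact congrArg Subrepresentation.toSubmodule h
  have hcomm (x y : F) : Commute (ρ x) (ρ y) := by
    rw [Commute, SemiconjBy, ← map_mul, ← map_mul, ← Subgroup.coe_mul, ← Subgroup.coe_mul,
      mul_comm' x y]
  have hind : LinearIndependent k w := by
    have h1 := Module.End.independent_iInf_maxGenEigenspace_of_forall_mapsTo
      (fun x : F => ρ x)
      (fun x y μ => Module.End.mapsTo_maxGenEigenspace_of_comm (hcomm y x) μ)
    have hinj : Function.Injective (fun (q : G ⧸ F) (x : F) => l (c q.out x)) := by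
      intro q r h
      have h2 : (q.out)⁻¹ * r.out ∈ F := by
        apply hstab
        intro x
        have := congrFun h (⟨q.out * x * (q.out)⁻¹, (inferInstance : F.Normal).conj_mem _ x.2 _⟩ : F)
        simp only at this
        convert this.symm using 2 <;> ext <;> simp [c, mul_assoc]
      rw [← QuotientGroup.eq] at h2
      simpa using h2
    refine (h1.comp hinj).linearIndependent _ (fun q => ?_) hw0
    simp only [Function.comp, Submodule.mem_iInf]
    intro x
    exact Module.End.mem_maxGenEigenspace _ _ _ |>.2 ⟨1, by simp [w, hc]⟩
  have := Fintype.ofFinite (G ⧸ F)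
  rw [Module.finrank_eq_card_basis (Basis.mk hind hspan.ge), Subgroup.index, Nat.card_eq_fintype_card]

end FrobeniusKernel

end Representation

/-- If a multiset of `p`-power roots of unity sums to zero, then `p` divides its size. -/
theorem Multiset.prime_dvd_card_of_sum_eq_zero {K : Type*} [Field K] [CharZero K] [IsAlgClosed K]
    {p : ℕ} [hp : Fact p.Prime] (m : ℕ) (s : Multiset K) (hs : ∀ z ∈ s, z ^ p ^ m = 1)
    (h0 : s.sum = 0) : p ∣ s.card := by
  have : NeZero (p ^ (m + 1)) := ⟨pow_ne_zero _ hp.out.ne_zero⟩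
  obtain ⟨ζ, hζ⟩ := HasEnoughRootsOfUnity.exists_primitiveRoot K (p ^ (m + 1))
  have hex (z : K) : ∃ i : ℕ, z ∈ s → ζ ^ i = z := by
    by_cases hz : z ∈ s
    · obtain ⟨i, -, hi⟩ := hζ.eq_pow_of_pow_eq_one (ξ := z) (by
        rw [pow_succ, pow_mul, hs z hz, one_pow])
      exact ⟨i, fun _ => hi⟩
    · exact ⟨0, fun h => (hz h).elim⟩
  choose e he using hex
  let f : ℤ[X] := (s.map fun z => X ^ e z).sum
  have hf : aeval ζ f = 0 := by
    simp only [f, map_multiset_sum, Multiset.map_map, Function.comp_def, map_pow, aeval_X]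
    rw [Multiset.map_congr rfl he, Multiset.map_id', h0]
  have hdvd : cyclotomic (p ^ (m + 1)) ℤ ∣ f := by
    rw [cyclotomic_eq_minpoly hζ (NeZero.pos _)]
    exact minpoly.isIntegrallyClosed_dvd (hζ.isIntegral (NeZero.pos _)) hf
  have h1 := eval_dvd (x := 1) hdvd
  rw [eval_one_cyclotomic_prime_pow] at h1
  have h2 : eval 1 f = s.card := by
    rw [← coe_evalRingHom]
    simp [f, map_multiset_sum]
  rw [h2] at h1
  exact_mod_cast h1

/-- The trace of an operator of `p`-power order on a space of dimension prime to `p` is nonzero. -/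
theorem LinearMap.trace_ne_zero_of_pow_eq_one {K V : Type*} [Field K] [CharZero K] [IsAlgClosed K]
    [AddCommGroup V] [Module K V] [FiniteDimensional K V] {p : ℕ} [Fact p.Prime] {m : ℕ}
    {f : Module.End K V} (hf : f ^ p ^ m = 1) (hdim : ¬ p ∣ finrank K V) :
    LinearMap.trace K V f ≠ 0 := by
  intro h0
  have hsplit := IsAlgClosed.splits f.charpoly
  rw [Module.End.trace_eq_sum_roots_charpoly_of_splits hsplit] at h0
  have h1 := Multiset.prime_dvd_card_of_sum_eq_zero (p := p) m f.charpoly.roots (by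
    intro z hz
    have hz' : f.HasEigenvalue z := by
      rw [Module.End.hasEigenvalue_iff_isRoot_charpoly]
      exact isRoot_of_mem_roots hz
    obtain ⟨v, hv⟩ := hz'.exists_hasEigenvector
    have h2 := hv.pow_apply (p ^ m)
    rw [hf, Module.End.one_apply] at h2
    apply smul_left_injective K hv.2
    simpa using h2.symm) h0
  rw [splits_iff_card_roots.1 hsplit, LinearMap.charpoly_natDegree] at h1
  exact hdim h1

namespace FDRep

variable {k G V : Type} [Field k] [Group G]

theorem isIrreducible_of_simple (V : FDRep k G) [Simple V] : Representation.IsIrreducible V.ρ := by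
  have hnt : Nontrivial (Subrepresentation V.ρ) := by
    refine ⟨⊥, ⊤, fun h => ?_⟩
    apply Simple.not_isZero V
    have h2 : (⊥ : Submodule k V) = ⊤ := congrArg Subrepresentation.toSubmodule h
    have h3 : Subsingleton V := (Submodule.subsingleton_iff k).1 (subsingleton_of_bot_eq_top h2)
    rw [Limits.IsZero.iff_id_eq_zero]
    ext x
    exact Subsingleton.elim (α := V) _ _
  refine ⟨fun W => ?_⟩
  let i : FDRep.of W.toRepresentation ⟶ V :=
    ⟨FGModuleCat.ofHom W.toSubmodule.subtype, fun g => by ext; rfl⟩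
  have hi : Mono i := by
    refine ⟨fun a b h => ?_⟩
    ext x
    have := congrArg (fun t => t.hom.hom.hom x) h
    exact this
  by_cases h0 : i = 0
  · left
    apply Subrepresentation.toSubmodule_injective
    refine (Submodule.eq_bot_iff _).2 fun x hx => ?_
    exact congrArg (fun t => t.hom.hom.hom (⟨x, hx⟩ : W.toSubmodule)) h0
  · right
    have := isIso_of_mono_of_nonzero h0
    apply Subrepresentation.toSubmodule_injective
    refine (Submodule.eq_top_iff').2 fun x => ?_
    have h := congrArg (fun t => t.hom.hom.hom x) (IsIso.inv_hom_id i)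
    have h' : (((inv i).hom.hom.hom x : W.toSubmodule) : V) = x := h
    rw [← h']
    exact Subtype.prop _

theorem simple_of_isIrreducible [CharZero k] [IsAlgClosed k] [Finite G] [AddCommGroup V]
    [Module k V] [FiniteDimensional k V] (ρ : Representation k G V)
    [Representation.IsIrreducible ρ] : Simple (FDRep.of ρ) := by
  have := Fintype.ofFinite G
  have : NeZero (Nat.card G : k) := ⟨by simp⟩
  have : Invertible (Nat.card G : k) := invertibleOfNonzero (NeZero.ne _)
  rw [simple_iff_char_is_norm_one]
  have h := Representation.card_inv_mul_sum_char_mul_char_eq_finrank ρ ρ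
  rw [Representation.IsIrreducible.finrank_intertwiningMap_self] at h
  rw [inv_mul_eq_iff_eq_mul₀ (NeZero.ne _)] at h
  rw [Nat.cast_one, mul_one] at h
  exact h

end FDRep

theorem Subgroup.not_dvd_index_of_centralizer_le {G : Type*} [Group G] [Finite G]
    {F : Subgroup G} [hN : F.Normal] (hbot : F ≠ ⊥)
    (hC : ∀ x ∈ F, x ≠ 1 → ∀ g : G, g * x = x * g → g ∈ F)
    {p : ℕ} [Fact p.Prime] (hpF : IsPGroup p F) : ¬ p ∣ F.index := by
  obtain ⟨P, hP⟩ := hpF.exists_le_sylow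
  have hdvd : p ∣ Nat.card F := by
    have := (Subgroup.nontrivial_iff_ne_bot F).2 hbot
    obtain ⟨n, hn0, hn⟩ := hpF.nontrivial_iff_card.1 this
    exact hn ▸ dvd_pow_self _ hn0.ne'
  let act : MulAction P F := MulAction.compHom F ((MulAut.conjNormal (H := F)).comp (P : Subgroup G).subtype)
  have hfix : (1 : F) ∈ MulAction.fixedPoints P F := fun g => map_one (MulAut.conjNormal (H := F) (g : G))
  obtain ⟨x, hx, hx1⟩ := P.2.exists_fixed_point_of_prime_dvd_card_of_fixed_point F hdvd hfix
  have hPF : (P : Subgroup G) ≤ F := by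
    intro g hg
    refine hC x x.2 (fun h => hx1 (Subtype.ext h.symm)) g ?_
    have h := congrArg Subtype.val (hx ⟨g, hg⟩)
    have h' : g * x * g⁻¹ = x := h
    rw [mul_inv_eq_iff_eq_mul] at h'
    exact h'
  rw [← le_antisymm hPF hP]
  exact P.not_dvd_index

end

section FrobeniusKernel

variable {G : Type} [Group G] [Finite G] {F : Subgroup G}

/-- If the sum of the elements of a normal subgroup kills a nonzero vector of a representation, then
it acts as zero on some irreducible representation. -/
theorem FDRep.exists_simple_sum_eq_zero_of_apply_eq_zero [F.Normal] [Fintype F] {V : Type}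
    [AddCommGroup V] [Module ℂ V] [FiniteDimensional ℂ V] (ρ : Representation ℂ G V) {v : V}
    (hv : v ≠ 0) (hsum : (∑ x : F, ρ x) v = 0) :
    ∃ U : FDRep ℂ G, Simple U ∧ ∑ x : F, U.ρ x = 0 := by
  let W : Subrepresentation ρ :=
    ⟨LinearMap.ker (∑ x : F, ρ x), by
      intro g v hv
      rw [LinearMap.mem_ker] at hv ⊢
      have h : ∑ x : F, ρ x (ρ g v) = ρ g ((∑ x : F, ρ x) v) := by
        rw [LinearMap.sum_apply, map_sum]
        refine Fintype.sum_equiv (MulAut.conjNormal (H := F) g⁻¹).toEquiv _ _ fun x => ?_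
        rw [← Module.End.mul_apply, ← Module.End.mul_apply, ← map_mul, ← map_mul]
        congr 2
        simp [mul_assoc]
      rw [LinearMap.sum_apply, h, hv, map_zero]⟩
  have hW : Nontrivial W.toSubmodule :=
    (Submodule.nontrivial_iff_ne_bot).2 ((Submodule.ne_bot_iff _).2 ⟨v, hsum, hv⟩)
  obtain ⟨U, hU⟩ := W.toRepresentation.exists_isIrreducible_subrepresentation
  refine ⟨FDRep.of U.toRepresentation, FDRep.simple_of_isIrreducible _, ?_⟩
  rw [FDRep.of_ρ']
  ext1 u
  apply Subtype.ext
  apply Subtype.ext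
  have h := LinearMap.mem_ker.1 u.1.2
  rw [LinearMap.sum_apply] at h ⊢
  simpa using! h

/-- There is an irreducible complex representation on which the sum of the elements of a nontrivial
normal subgroup acts as zero. -/
theorem FDRep.exists_simple_sum_eq_zero [F.Normal] [Fintype F] (hbot : F ≠ ⊥) :
    ∃ V : FDRep ℂ G, Simple V ∧ ∑ x : F, V.ρ x = 0 := by
  obtain ⟨y, hy1⟩ := Subgroup.ne_bot_iff_exists_ne_one.1 hbot
  refine FDRep.exists_simple_sum_eq_zero_of_apply_eq_zero (Representation.leftRegular ℂ G)
    (v := MonoidAlgebra.single (y : G) (1 : ℂ) - MonoidAlgebra.single 1 1) ?_ ?_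
  · rw [sub_ne_zero]
    exact fun h => hy1 (Subtype.ext (MonoidAlgebra.single_left_injective one_ne_zero h))
  · simp only [map_sub, LinearMap.sum_apply, Representation.ofMulAction_single, smul_eq_mul,
      mul_one, sub_eq_zero]
    exact Fintype.sum_equiv (Equiv.mulRight y) _
      (fun x : F => MonoidAlgebra.single (x : G) (1 : ℂ)) fun _ => rfl

theorem isVanishing_of_notMem [F.Normal] (hbot : F ≠ ⊥)
    (hC : ∀ x ∈ F, x ≠ 1 → ∀ g : G, g * x = x * g → g ∈ F) {g : G} (hg : g ∉ F) :
    IsVanishing g := by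
  have := Fintype.ofFinite F
  obtain ⟨V, hV, hsum⟩ := FDRep.exists_simple_sum_eq_zero hbot
  exact ⟨V, hV, Representation.character_eq_zero_of_sum_eq_zero V.ρ hC hsum hg⟩

theorem not_isVanishing_of_mem [F.Normal] [IsMulCommutative F] (hbot : F ≠ ⊥)
    (hC : ∀ x ∈ F, x ≠ 1 → ∀ g : G, g * x = x * g → g ∈ F) {p : ℕ} [Fact p.Prime]
    (hpF : IsPGroup p F) {g : G} (hg : g ∈ F) : ¬ IsVanishing g := by
  have := Fintype.ofFinite F
  rintro ⟨V, hV, h0⟩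
  have hirr := FDRep.isIrreducible_of_simple V
  rcases Representation.sum_eq_zero_or_forall_eq_one (F := F) V.ρ with h | h
  · have hdim := Representation.finrank_eq_index_of_sum_eq_zero V.ρ hC h
    obtain ⟨m, hm⟩ := hpF ⟨g, hg⟩
    have hgm : g ^ p ^ m = 1 := congrArg Subtype.val hm
    refine LinearMap.trace_ne_zero_of_pow_eq_one (p := p) (m := m) (f := V.ρ g) ?_ ?_ h0
    · rw [← map_pow, hgm, map_one]
    · rw [hdim]
      exact Subgroup.not_dvd_index_of_centralizer_le hbot hC hpF
  · have hnt : Nontrivial V := by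
      by_contra hs
      rw [not_nontrivial_iff_subsingleton] at hs
      exact bot_ne_top (α := Subrepresentation V.ρ)
        (Subrepresentation.toSubmodule_injective (Subsingleton.elim _ _))
    have h1 : LinearMap.trace ℂ V (V.ρ g) = 0 := h0
    rw [h g hg, LinearMap.trace_one, Nat.cast_eq_zero] at h1
    exact Module.finrank_pos.ne' h1

end FrobeniusKernel

theorem stmt8 (G : Type) [Group G] [Finite G] (F : Subgroup G) (p : ℕ) (hp : p.Prime)
    (hF : IsFrobeniusWithKernel G F) (hab : ∀ x y : F, x * y = y * x)
    (hpF : IsPGroup p F) (n : ℕ) (hn : F.index = n) :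
    {g : G | IsVanishing g} = {g : G | g ∉ F} ∧ pv G = 1 - 1 / (n : ℝ) := by
  obtain ⟨hnormal, hbot, -, hC⟩ := hF
  have : Fact p.Prime := ⟨hp⟩
  have : IsMulCommutative F := ⟨⟨hab⟩⟩
  have hset : {g : G | IsVanishing g} = {g : G | g ∉ F} := by
    ext g
    exact ⟨fun hv hg => not_isVanishing_of_mem hbot hC hpF hg hv, isVanishing_of_notMem hbot hC⟩
  refine ⟨hset, ?_⟩
  have hcompl : {g : G | g ∉ F} = (F : Set G)ᶜ := rfl
  have hF0 : (Nat.card F : ℝ) ≠ 0 := by exact_mod_cast Nat.card_pos.ne'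
  have hn0 : (n : ℝ) ≠ 0 := by exact_mod_cast hn ▸ Subgroup.index_ne_zero_of_finite
  have hcard : (Nat.card G : ℝ) = Nat.card F * n := by
    exact_mod_cast hn ▸ F.card_mul_index.symm
  have hadd : (Nat.card F : ℝ) + (F : Set G)ᶜ.ncard = Nat.card G := by
    exact_mod_cast Set.ncard_add_ncard_compl (F : Set G)
  rw [pv, hset, hcompl, eq_sub_of_add_eq' hadd, hcard]
  field_simp
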